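/- Suppose H is a [3]-graph on n ≥ 69 vertices such that every pair of non-adjacent vertices u, v satisfies d_{∂H}(u) + d_{∂H}(v) ≥ n + 65, and H contains no Hamiltonian Berge cycle. Let C = v_1, e_1, ..., v_ℓ, e_ℓ, v_1 be a longest Berge cycle in H with ℓ ∈ {n−1, n−2}, let u ∈ V(H) − V(C), let U_u ⊆ V(C) be a usable set for u with |U_u| ≥ d_C(u)/6, and let X = {v_{i+1} : v_i ∈ U_u ∩ B_1(C)}, where B_1(C) = {v : (n+65)/2 − 3 ≤ d_C(v) < 3n/4 + 13}. If v_{i+1} ∈ X is adjacent to u, then E(u, v_{i+1}) = {e_{i+1}}. -/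

import Mathlib

/-- Two vertices are adjacent in the hypergraph with edge set `H`
if some edge contains both of them. -/
def HAdj {V : Type*} (H : Finset (Finset V)) (u v : V) : Prop :=
  u ≠ v ∧ ∃ e ∈ H, u ∈ e ∧ v ∈ e

/-- The degree of `u` in the 2-shadow `∂H`: the number of vertices adjacent to `u`. -/
noncomputable def shadowDeg {V : Type*} (H : Finset (Finset V)) (u : V) : ℕ :=
  {v | HAdj H u v}.ncard

/-- A `[3]`-graph: every edge has exactly 2 or 3 vertices. -/
def IsThreeGraph {V : Type*} (H : Finset (Finset V)) : Prop :=
  ∀ e ∈ H, e.card = 2 ∨ e.card = 3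

/-- A Berge cycle of length `t` in the hypergraph with edge set `H`:
`t` distinct vertices `vtx i` and `t` distinct edges `edge i` (indices mod `t`)
with `{vtx i, vtx (i+1)} ⊆ edge i` for every `i`. -/
structure BergeCycle {V : Type*} (H : Finset (Finset V)) (t : ℕ) where
  vtx : ZMod t → V
  edge : ZMod t → Finset V
  vtx_inj : Function.Injective vtx
  edge_inj : Function.Injective edge
  edge_mem : ∀ i, edge i ∈ H
  mem_fst : ∀ i, vtx i ∈ edge i
  mem_snd : ∀ i, vtx (i + 1) ∈ edge i

/-- `d_C(u)`: the number of vertices of the Berge cycle `C` adjacent to `u`. -/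
noncomputable def BergeCycle.dC {V : Type*} {H : Finset (Finset V)} {t : ℕ}
    (C : BergeCycle H t) (u : V) : ℕ :=
  {v | v ∈ Set.range C.vtx ∧ HAdj H u v}.ncard

/-- `H` contains a Hamiltonian Berge cycle, i.e. a Berge cycle whose
vertex set is all of `V`. -/
def HamiltonianBergeCycle {V : Type*} (H : Finset (Finset V)) : Prop :=
  ∃ (t : ℕ) (C : BergeCycle H t), Set.range C.vtx = Set.univ

/-- A set `U` of indices of vertices of the Berge cycle `C` is usable for `u`:
(1) for every `i ∈ U` there is an edge in `E(u, v_{i-1}) - {e_{i-2}}`;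
(2) any two distinct `i, j ∈ U` are non-consecutive on `C`;
(3) for every pair of distinct `i, j ∈ U` there are distinct edges
`e ∈ E(u, v_{i-1}) - {e_{i-2}}` and `e' ∈ E(u, v_{j-1}) - {e_{j-2}}`. -/
def Usable {V : Type*} {H : Finset (Finset V)} {t : ℕ} (C : BergeCycle H t) (u : V)
    (U : Set (ZMod t)) : Prop :=
  (∀ i ∈ U, ∃ e ∈ H, e ≠ C.edge (i - 2) ∧ u ∈ e ∧ C.vtx (i - 1) ∈ e) ∧
  (∀ i ∈ U, ∀ j ∈ U, i ≠ j → j ≠ i + 1 ∧ j ≠ i - 1) ∧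
  (∀ i ∈ U, ∀ j ∈ U, i ≠ j → ∃ e ∈ H, ∃ e' ∈ H, e ≠ e' ∧
    e ≠ C.edge (i - 2) ∧ u ∈ e ∧ C.vtx (i - 1) ∈ e ∧
    e' ≠ C.edge (j - 2) ∧ u ∈ e' ∧ C.vtx (j - 1) ∈ e')

/-- `CwBtw a b c` : on the cycle oriented clockwise, `b` lies strictly between
`a` and `c` on the clockwise arc from `a` to `c`. -/
def CwBtw {t : ℕ} (a b c : ZMod t) : Prop :=
  0 < (b - a).val ∧ (b - a).val < (c - a).val

/-- `e` is an `(i,j;k)`-bridge of the Berge cycle `C`. -/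
def IsBridge {V : Type*} [DecidableEq V] {H : Finset (Finset V)} {t : ℕ}
    (C : BergeCycle H t) (i j k : ZMod t) (e : Finset V) : Prop :=
  (CwBtw i k j ∧ ((e = C.edge (k + 1) ∧ e = {C.vtx i, C.vtx (k + 1), C.vtx (k + 2)}) ∨
                (e = C.edge (k - 1) ∧ e = {C.vtx j, C.vtx k, C.vtx (k - 1)}))) ∨
  (CwBtw j k i ∧ ((e = C.edge (k - 1) ∧ e = {C.vtx i, C.vtx k, C.vtx (k - 1)}) ∨
                (e = C.edge (k + 1) ∧ e = {C.vtx j, C.vtx (k + 1), C.vtx (k + 2)})))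

/-- `R(v_i, v_j)`: the set of bridges produced by the pair `{v_i, v_j}`,
i.e. all `(i,j;k)`-bridges over `k ∉ {i, j}`. -/
def RBridges {V : Type*} [DecidableEq V] {H : Finset (Finset V)} {t : ℕ}
    (C : BergeCycle H t) (i j : ZMod t) : Set (Finset V) :=
  {e | ∃ k : ZMod t, k ≠ i ∧ k ≠ j ∧ IsBridge C i j k e}

open Classical in
theorem card_four {V : Type*} {H : Finset (Finset V)} (h3 : IsThreeGraph H) {e : Finset V}
    (he : e ∈ H) {a b c d : V} (ha : a ∈ e) (hb : b ∈ e) (hc : c ∈ e) (hd : d ∈ e)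
    (hab : a ≠ b) (hac : a ≠ c) (had : a ≠ d) (hbc : b ≠ c) (hbd : b ≠ d) (hcd : c ≠ d) :
    False := by
  have h1 : ({a, b, c, d} : Finset V).card = 4 := by
    rw [Finset.card_insert_of_notMem, Finset.card_insert_of_notMem,
      Finset.card_insert_of_notMem, Finset.card_singleton] <;> simp [*]
  have h2 : ({a, b, c, d} : Finset V) ⊆ e := by
    intro x hx; simp at hx; rcases hx with rfl | rfl | rfl | rfl <;> assumption
  have := Finset.card_le_card h2
  rcases h3 e he with h | h <;> omega

/-- A Berge path with vertices `x 0, ..., x t` and edges `y 0, ..., y (t-1)`. -/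
structure BPath {V : Type*} (H : Finset (Finset V)) (t : ℕ) (x : ℕ → V) (y : ℕ → Finset V) :
    Prop where
  xinj : ∀ a b, a ≤ t → b ≤ t → x a = x b → a = b
  yinj : ∀ a b, a < t → b < t → y a = y b → a = b
  ymem : ∀ a, a < t → y a ∈ H
  fst : ∀ a, a < t → x a ∈ y a
  snd : ∀ a, a < t → x (a + 1) ∈ y a

theorem BPath.close {V : Type*} {H : Finset (Finset V)} {t : ℕ} {x : ℕ → V} {y : ℕ → Finset V}
    (P : BPath H t x y) {g : Finset V} (hg : g ∈ H) (h0 : x 0 ∈ g) (ht : x t ∈ g)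
    (hne : ∀ r, r < t → y r ≠ g) : Nonempty (BergeCycle H (t + 1)) := by
  have hv : ∀ k : ZMod (t + 1), k.val ≤ t := fun k => Nat.lt_succ_iff.mp (ZMod.val_lt k)
  have hs : ∀ k : ZMod (t + 1), (k + 1).val = if k.val = t then 0 else k.val + 1 := by
    intro k
    rw [ZMod.val_add, ZMod.val_one_eq_one_mod, Nat.add_mod_mod]
    have := hv k
    split_ifs with h
    · rw [h, Nat.mod_self]
    · exact Nat.mod_eq_of_lt (by omega)
  refine ⟨⟨fun k => x k.val, fun k => if k.val < t then y k.val else g, ?_, ?_, ?_, ?_, ?_⟩⟩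
  · intro a b hab
    exact ZMod.val_injective _ (P.xinj _ _ (hv a) (hv b) hab)
  · intro a b hab
    apply ZMod.val_injective
    have := hv a
    have := hv b
    try dsimp only at hab
    split_ifs at hab with h1 h2 h2
    · exact P.yinj _ _ h1 h2 hab
    · exact absurd hab (hne _ h1)
    · exact absurd hab.symm (hne _ h2)
    · omega
  · intro k
    try dsimp only
    split_ifs with h
    · exact P.ymem _ h
    · exact hg
  · intro k
    have := hv k
    try dsimp only
    split_ifs with h
    · exact P.fst _ h
    · have : k.val = t := by omega
      rw [this]; exact ht
  · intro k
    have := hv k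
    try dsimp only
    rw [hs k]
    split_ifs with h h' h'
    · omega
    · exact P.snd _ h
    · exact h0
    · omega

theorem BPath.rot {V : Type*} {H : Finset (Finset V)} {t : ℕ} {x : ℕ → V} {y : ℕ → Finset V}
    (P : BPath H t x y) {g : Finset V} (hg : g ∈ H) {s : ℕ} (hst : s < t) (h0 : x s ∈ g)
    (ht : x t ∈ g) (hne : ∀ r, r < t → r ≠ s → y r ≠ g) :
    BPath H t (fun r => if r ≤ s then x r else x (t + s + 1 - r))
      (fun r => if r < s then y r else if r = s then g else y (t + s - r)) := by
  refine ⟨?_, ?_, ?_, ?_, ?_⟩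
  · intro a b ha hb hab
    try dsimp only at hab
    split_ifs at hab with h1 h2 h2 <;> have := P.xinj _ _ (by omega) (by omega) hab <;> omega
  · intro a b ha hb hab
    try dsimp only at hab
    split_ifs at hab with h1 h2 h3 h4 h5 h6 h7 h8
    all_goals first
      | omega
      | (have := P.yinj _ _ (by omega) (by omega) hab; omega)
      | exact absurd hab (hne _ (by omega) (by omega))
      | exact absurd hab.symm (hne _ (by omega) (by omega))
  · intro a ha
    try dsimp only
    split_ifs
    · exact P.ymem _ ha
    · exact hg
    · exact P.ymem _ (by omega)
  · intro a ha
    try dsimp only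
    split_ifs with h1 h2 h3 h4 h5
    any_goals omega
    · exact P.fst _ ha
    · subst h3; exact h0
    · have := P.snd (t + s - a) (by omega)
      rwa [show t + s - a + 1 = t + s + 1 - a by omega] at this
  · intro a ha
    try dsimp only
    split_ifs with h1 h2 h3 h4 h5
    any_goals omega
    · exact P.snd _ ha
    · subst h3
      rwa [show t + a + 1 - (a + 1) = t by omega]
    · have := P.fst (t + s - a) (by omega)
      rwa [show t + s + 1 - (a + 1) = t + s - a by omega]

theorem BPath.cross {V : Type*} {H : Finset (Finset V)} {t : ℕ} {x : ℕ → V} {y : ℕ → Finset V}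
    (P : BPath H t x y) {g g' : Finset V} (hg : g ∈ H) (hg' : g' ∈ H) {s : ℕ} (hst : s < t)
    (h0 : x 0 ∈ g) (h1 : x (s + 1) ∈ g) (h2 : x s ∈ g') (h3 : x t ∈ g') (hgg : g ≠ g')
    (hne : ∀ r, r < t → r ≠ s → y r ≠ g) (hne' : ∀ r, r < t → r ≠ s → y r ≠ g') :
    Nonempty (BergeCycle H (t + 1)) := by
  refine (P.rot hg' hst h2 h3 hne').close hg ?_ ?_ ?_
  · simpa using h0
  · rw [if_neg (by omega), show t + s + 1 - t = s + 1 by omega]; exact h1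
  · intro r hr
    try dsimp only
    split_ifs
    · exact hne _ hr (by omega)
    · exact hgg.symm
    · exact hne _ (by omega) (by omega)

open Classical in
theorem BPath.count {V : Type*} {H : Finset (Finset V)} {t : ℕ} {x : ℕ → V} {y : ℕ → Finset V}
    (h3 : IsThreeGraph H) (P : BPath H t x y) (hno : IsEmpty (BergeCycle H (t + 1))) :
    ((Finset.range t).filter (fun s => (∃ g ∈ H, x 0 ∈ g ∧ x (s + 1) ∈ g) ∧
      ∃ g ∈ H, x s ∈ g ∧ x t ∈ g)).card ≤ 4 +
      ((Finset.range t).filter (fun r => 1 ≤ r ∧ x 0 ∈ y r)).card +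
      ((Finset.range t).filter (fun r => r + 1 < t ∧ x t ∈ y r)).card := by
  set A := (Finset.range t).filter (fun r => 1 ≤ r ∧ x 0 ∈ y r) with hA
  set B := (Finset.range t).filter (fun r => r + 1 < t ∧ x t ∈ y r) with hB
  set S0 := (Finset.range t).filter (fun s => 1 ≤ s ∧ x (s + 1) ∈ y 0) with hS0
  set S1 := (Finset.range t).filter (fun s => s + 1 < t ∧ x s ∈ y (t - 1)) with hS1
  have hxne : ∀ a b, a ≤ t → b ≤ t → a ≠ b → x a ≠ x b := fun a b ha hb hab h =>
    hab (P.xinj a b ha hb h)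
  have c0 : S0.card ≤ 1 := by
    rw [Finset.card_le_one]
    intro a ha b hb
    simp only [hS0, Finset.mem_filter, Finset.mem_range] at ha hb
    by_contra hab
    have k0 := P.fst 0 (by omega)
    have k1 := P.snd 0 (by omega)
    exact card_four h3 (P.ymem 0 (by omega)) k0 k1 ha.2.2 hb.2.2
      (hxne _ _ (by omega) (by omega) (by omega)) (hxne _ _ (by omega) (by omega) (by omega))
      (hxne _ _ (by omega) (by omega) (by omega)) (hxne _ _ (by omega) (by omega) (by omega))
      (hxne _ _ (by omega) (by omega) (by omega)) (hxne _ _ (by omega) (by omega) (by omega))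
  have c1 : S1.card ≤ 1 := by
    rw [Finset.card_le_one]
    intro a ha b hb
    simp only [hS1, Finset.mem_filter, Finset.mem_range] at ha hb
    by_contra hab
    have k0 := P.fst (t - 1) (by omega)
    have k1 := P.snd (t - 1) (by omega)
    exact card_four h3 (P.ymem (t - 1) (by omega)) k0 k1 ha.2.2 hb.2.2
      (hxne _ _ (by omega) (by omega) (by omega)) (hxne _ _ (by omega) (by omega) (by omega))
      (hxne _ _ (by omega) (by omega) (by omega)) (hxne _ _ (by omega) (by omega) (by omega))
      (hxne _ _ (by omega) (by omega) (by omega)) (hxne _ _ (by omega) (by omega) (by omega))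
  have hsub : (Finset.range t).filter (fun s => (∃ g ∈ H, x 0 ∈ g ∧ x (s + 1) ∈ g) ∧
      ∃ g ∈ H, x s ∈ g ∧ x t ∈ g) ⊆
      {0, t - 1} ∪ S0 ∪ S1 ∪ A.image (fun r => r - 1) ∪ B.image (fun r => r + 1) := by
    intro s hs
    simp only [Finset.mem_filter, Finset.mem_range] at hs
    obtain ⟨hst, ⟨g, hg, hg0, hg1⟩, g', hg', hg2, hg3⟩ := hs
    by_contra hcon
    simp only [Finset.mem_union, Finset.mem_insert, Finset.mem_singleton, Finset.mem_image,
      not_or, not_exists, not_and] at hcon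
    obtain ⟨⟨⟨⟨⟨n0, n1⟩, nS0⟩, nS1⟩, nA⟩, nB⟩ := hcon
    simp only [hS0, hS1, hA, hB, Finset.mem_filter, Finset.mem_range] at nS0 nS1 nA nB
    have key : Nonempty (BergeCycle H (t + 1)) := by
      refine P.cross hg hg' hst hg0 hg1 hg2 hg3 ?_ ?_ ?_
      · rintro rfl
        exact card_four h3 hg hg0 hg1 hg2 hg3
          (hxne _ _ (by omega) (by omega) (by omega)) (hxne _ _ (by omega) (by omega) (by omega))
          (hxne _ _ (by omega) (by omega) (by omega)) (hxne _ _ (by omega) (by omega) (by omega))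
          (hxne _ _ (by omega) (by omega) (by omega)) (hxne _ _ (by omega) (by omega) (by omega))
      · rintro r hr hrs rfl
        have k0 := P.fst r hr
        have k1 := P.snd r hr
        by_cases hr0 : r = 0
        · subst hr0
          exact nS0 ⟨hst, by omega, hg1⟩
        by_cases hr1 : r = s + 1
        · exact nA r ⟨hr, by omega, hg0⟩ (by omega)
        exact card_four h3 hg hg0 hg1 k0 k1
          (hxne _ _ (by omega) (by omega) (by omega)) (hxne _ _ (by omega) (by omega) (by omega))
          (hxne _ _ (by omega) (by omega) (by omega)) (hxne _ _ (by omega) (by omega) (by omega))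
          (hxne _ _ (by omega) (by omega) (by omega)) (hxne _ _ (by omega) (by omega) (by omega))
      · rintro r hr hrs rfl
        have k0 := P.fst r hr
        have k1 := P.snd r hr
        by_cases hr0 : r = t - 1
        · subst hr0
          exact nS1 ⟨hst, by omega, hg2⟩
        by_cases hr1 : r + 1 = s
        · exact nB r ⟨hr, by omega, hg3⟩ (by omega)
        exact card_four h3 hg' hg2 hg3 k0 k1
          (hxne _ _ (by omega) (by omega) (by omega)) (hxne _ _ (by omega) (by omega) (by omega))
          (hxne _ _ (by omega) (by omega) (by omega)) (hxne _ _ (by omega) (by omega) (by omega))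
          (hxne _ _ (by omega) (by omega) (by omega)) (hxne _ _ (by omega) (by omega) (by omega))
    exact hno.elim key.some
  have u0 := Finset.card_le_card hsub
  have u1 := Finset.card_union_le ({0, t - 1} ∪ S0 ∪ S1 ∪ A.image (fun r => r - 1))
    (B.image (fun r => r + 1))
  have u2 := Finset.card_union_le ({0, t - 1} ∪ S0 ∪ S1) (A.image (fun r => r - 1))
  have u3 := Finset.card_union_le ({0, t - 1} ∪ S0) S1
  have u4 := Finset.card_union_le {0, t - 1} S0
  have u5 : (A.image (fun r => r - 1)).card ≤ A.card := Finset.card_image_le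
  have u6 : (B.image (fun r => r + 1)).card ≤ B.card := Finset.card_image_le
  have u7 : ({0, t - 1} : Finset ℕ).card ≤ 2 := Finset.card_le_two
  omega

/-- degree count on a Hamiltonian-like path -/
theorem BPath.deg {V : Type*} [Fintype V] {H : Finset (Finset V)} {t : ℕ} {x : ℕ → V}
    {y : ℕ → Finset V}
    (h3 : IsThreeGraph H) (P : BPath H t x y) (hno : IsEmpty (BergeCycle H (t + 1)))
    {a b : ℕ} 
    (ha : {e | e ∈ H ∧ ∃ r, r < t ∧ 1 ≤ r ∧ e = y r ∧ x 0 ∈ e}.ncard ≤ a)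
    (hb : {e | e ∈ H ∧ ∃ r, r < t ∧ r + 1 < t ∧ e = y r ∧ x t ∈ e}.ncard ≤ b) :
    shadowDeg H (x 0) + shadowDeg H (x t) ≤ t + 4 + a + b + 2 * (Fintype.card V - (t + 1)) := by
  classical
  have hc := P.count h3 hno
  have ha' : ((Finset.range t).filter (fun r => 1 ≤ r ∧ x 0 ∈ y r)).card ≤ a := by
    refine le_trans ?_ ha
    rw [← Set.ncard_coe_finset]
    refine Set.ncard_le_ncard_of_injOn y ?_ ?_ (H.finite_toSet.subset fun e he => he.1)
    · intro r hr
      simp at hr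
      exact ⟨P.ymem r hr.1, r, hr.1, hr.2.1, rfl, hr.2.2⟩
    · intro r hr r' hr' h
      simp at hr hr'
      exact P.yinj _ _ hr.1 hr'.1 h
  have hb' : ((Finset.range t).filter (fun r => r + 1 < t ∧ x t ∈ y r)).card ≤ b := by
    refine le_trans ?_ hb
    rw [← Set.ncard_coe_finset]
    refine Set.ncard_le_ncard_of_injOn y ?_ ?_ (H.finite_toSet.subset fun e he => he.1)
    · intro r hr
      simp at hr
      exact ⟨P.ymem r hr.1, r, hr.1, hr.2.1, rfl, hr.2.2⟩
    · intro r hr r' hr' h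
      simp at hr hr'
      exact P.yinj _ _ hr.1 hr'.1 h
  set Q : Finset V := (Finset.range (t + 1)).image x with hQ
  have hQc : Q.card = t + 1 := by
    rw [hQ, Finset.card_image_of_injOn, Finset.card_range]
    intro r hr r' hr' h
    simp at hr hr'
    exact P.xinj _ _ (by omega) (by omega) h
  have hQc' : (Finset.univ \ Q).card = Fintype.card V - (t + 1) := by
    rw [Finset.card_sdiff_of_subset (Finset.subset_univ _), hQc, Finset.card_univ]
  set D0 := (Finset.range t).filter (fun s => (∃ g ∈ H, x 0 ∈ g ∧ x (s + 1) ∈ g)) with hD0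
  set D1 := (Finset.range t).filter (fun s => (∃ g ∈ H, x s ∈ g ∧ x t ∈ g)) with hD1
  have e0 : shadowDeg H (x 0) ≤ D0.card + (Fintype.card V - (t + 1)) := by
    have : {v | HAdj H (x 0) v} ⊆ ((D0.image (fun s => x (s + 1)) ∪ (Finset.univ \ Q) : Finset V) : Set V) := by
      rintro v ⟨hne, g, hg, h0, h1⟩
      by_cases hv : v ∈ Q
      · simp only [hQ, Finset.mem_image, Finset.mem_range] at hv
        obtain ⟨k, hk, rfl⟩ := hv
        have hk0 : k ≠ 0 := by rintro rfl; exact hne rfl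
        simp only [Finset.coe_union, Set.mem_union, Finset.mem_coe, Finset.mem_image]
        left
        refine ⟨k - 1, ?_, by rw [Nat.sub_add_cancel (by omega)]⟩
        simp only [hD0, Finset.mem_filter, Finset.mem_range]
        refine ⟨by omega, g, hg, h0, by rwa [Nat.sub_add_cancel (by omega)]⟩
      · simp [hv]
    have h := Set.ncard_le_ncard this (Finset.finite_toSet _)
    rw [Set.ncard_coe_finset] at h
    refine h.trans ((Finset.card_union_le _ _).trans ?_)
    rw [hQc']
    exact Nat.add_le_add_right Finset.card_image_le _
  have e1 : shadowDeg H (x t) ≤ D1.card + (Fintype.card V - (t + 1)) := by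
    have : {v | HAdj H (x t) v} ⊆ ((D1.image (fun s => x s) ∪ (Finset.univ \ Q) : Finset V) : Set V) := by
      rintro v ⟨hne, g, hg, h0, h1⟩
      by_cases hv : v ∈ Q
      · simp only [hQ, Finset.mem_image, Finset.mem_range] at hv
        obtain ⟨k, hk, rfl⟩ := hv
        have hk0 : k ≠ t := by rintro rfl; exact hne rfl
        simp only [Finset.coe_union, Set.mem_union, Finset.mem_coe, Finset.mem_image]
        left
        refine ⟨k, ?_, rfl⟩
        simp only [hD1, Finset.mem_filter, Finset.mem_range]
        exact ⟨by omega, g, hg, h1, h0⟩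
      · simp [hv]
    have h := Set.ncard_le_ncard this (Finset.finite_toSet _)
    rw [Set.ncard_coe_finset] at h
    refine h.trans ((Finset.card_union_le _ _).trans ?_)
    rw [hQc']
    exact Nat.add_le_add_right Finset.card_image_le _
  have hi := Finset.card_union_add_card_inter D0 D1
  have hu : (D0 ∪ D1).card ≤ t := by
    have : D0 ∪ D1 ⊆ Finset.range t :=
      Finset.union_subset (Finset.filter_subset _ _) (Finset.filter_subset _ _)
    simpa using Finset.card_le_card this
  have hint : D0 ∩ D1 = (Finset.range t).filter (fun s => (∃ g ∈ H, x 0 ∈ g ∧ x (s + 1) ∈ g) ∧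
      ∃ g ∈ H, x s ∈ g ∧ x t ∈ g) := by
    rw [hD0, hD1, ← Finset.filter_and]
  rw [hint] at hi
  omega

/-- if the ends of the path are adjacent, then the edge is the first or last one -/
theorem BPath.ends {V : Type*} {H : Finset (Finset V)} {t : ℕ} {x : ℕ → V}
    {y : ℕ → Finset V} (ht : 2 ≤ t)
    (h3 : IsThreeGraph H) (P : BPath H t x y) (hno : IsEmpty (BergeCycle H (t + 1)))
    (h : HAdj H (x 0) (x t)) : x t ∈ y 0 ∨ x 0 ∈ y (t - 1) := by
  obtain ⟨-, g, hg, h0, h1⟩ := h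
  by_contra hcon
  push Not at hcon
  have hxne : ∀ a b, a ≤ t → b ≤ t → a ≠ b → x a ≠ x b := fun a b ha hb hab h =>
    hab (P.xinj a b ha hb h)
  refine hno.elim (P.close hg h0 h1 ?_).some
  rintro r hr rfl
  have hr0 : r ≠ 0 := by rintro rfl; exact hcon.1 h1
  have hr1 : r ≠ t - 1 := by rintro rfl; exact hcon.2 h0
  exact card_four h3 hg h0 h1 (P.fst r hr) (P.snd r hr)
    (hxne _ _ (by omega) (by omega) (by omega)) (hxne _ _ (by omega) (by omega) (by omega))
    (hxne _ _ (by omega) (by omega) (by omega)) (hxne _ _ (by omega) (by omega) (by omega))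
    (hxne _ _ (by omega) (by omega) (by omega)) (hxne _ _ (by omega) (by omega) (by omega))

theorem BergeCycle.third {V : Type*} {H : Finset (Finset V)} (h3 : IsThreeGraph H) {t : ℕ}
    (ht : 2 ≤ t) (C : BergeCycle H t) {u : V} (hu : u ∉ Set.range C.vtx) {k a : ZMod t}
    (h1 : u ∈ C.edge k) (h2 : C.vtx a ∈ C.edge k) : a = k ∨ a = k + 1 := by
  have : Fact (1 < t) := ⟨by omega⟩
  by_contra hcon
  push Not at hcon
  have hne : ∀ b, u ≠ C.vtx b := fun b h => hu ⟨b, h.symm⟩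
  exact card_four h3 (C.edge_mem k) h1 h2 (C.mem_fst k) (C.mem_snd k) (hne _) (hne _) (hne _)
    (C.vtx_inj.ne hcon.1) (C.vtx_inj.ne hcon.2) (C.vtx_inj.ne (by simp))

theorem zmod_sub_one {t : ℕ} (ht : 4 ≤ t) (i : ZMod t) (m : ℕ) (hm : 1 ≤ m) :
    i + (m : ZMod t) - 1 = i + ((m - 1 : ℕ) : ZMod t) := by
  rw [Nat.cast_sub hm]; push_cast; ring

theorem zmod_sub_two {t : ℕ} (ht : 4 ≤ t) (i : ZMod t) (m : ℕ) (hm : 2 ≤ m) :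
    i + (m : ZMod t) - 2 = i + ((m - 2 : ℕ) : ZMod t) := by
  rw [Nat.cast_sub hm]; push_cast; ring

theorem zmod_inj {t : ℕ} (i : ZMod t) {a b : ℕ} (ha : a < t) (hb : b < t)
    (h : i + (a : ZMod t) = i + (b : ZMod t)) : a = b := by
  have := add_left_cancel h
  rw [ZMod.natCast_eq_natCast_iff', Nat.mod_eq_of_lt ha, Nat.mod_eq_of_lt hb] at this
  exact this

/-- The path `v_i, ..., v_{j-1}, u, v_{i-1}, ..., v_j`, with `j = i + m`. -/
theorem BergeCycle.path {V : Type*} {H : Finset (Finset V)} (h3 : IsThreeGraph H) {t : ℕ}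
    (ht : 4 ≤ t) (C : BergeCycle H t) {u : V} (hu : u ∉ Set.range C.vtx) (i : ZMod t) (m : ℕ)
    (hm : 2 ≤ m) (hmt : m + 2 ≤ t) {f f' : Finset V} (hf : f ∈ H) (hf' : f' ∈ H) (hff : f ≠ f')
    (f1 : f ≠ C.edge (i - 2)) (f2 : u ∈ f) (f3 : C.vtx (i - 1) ∈ f)
    (f1' : f' ≠ C.edge (i + m - 2)) (f2' : u ∈ f') (f3' : C.vtx (i + m - 1) ∈ f') :
    BPath H t (fun r => if r < m then C.vtx (i + r) else if r = m then u else
        C.vtx (i + ((t + m - r : ℕ) : ZMod t)))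
      (fun r => if r + 1 < m then C.edge (i + r) else if r + 1 = m then f' else
        if r = m then f else C.edge (i + ((t + m - 1 - r : ℕ) : ZMod t))) := by
  have hi : i = i + ((t : ℕ) : ZMod t) := by simp
  rw [hi, zmod_sub_two ht i t (by omega)] at f1
  rw [hi, zmod_sub_one ht i t (by omega)] at f3
  rw [zmod_sub_two ht i m (by omega)] at f1'
  rw [zmod_sub_one ht i m (by omega)] at f3'
  have vinj : ∀ a b : ℕ, a < t → b < t → C.vtx (i + a) = C.vtx (i + b) → a = b :=
    fun a b ha hb h => zmod_inj i ha hb (C.vtx_inj h)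
  have einj : ∀ a b : ℕ, a < t → b < t → C.edge (i + a) = C.edge (i + b) → a = b :=
    fun a b ha hb h => zmod_inj i ha hb (C.edge_inj h)
  have hune : ∀ b, u ≠ C.vtx b := fun b h => hu ⟨b, h.symm⟩
  have hune' : ∀ b, C.vtx b ≠ u := fun b h => hu ⟨b, h⟩
  have hsnd : ∀ a : ℕ, C.vtx (i + ((a + 1 : ℕ) : ZMod t)) ∈ C.edge (i + a) := by
    intro a
    have := C.mem_snd (i + a)
    rwa [add_assoc, ← Nat.cast_succ] at this
  have hfe : ∀ k, k + 1 < t → f ≠ C.edge (i + (k : ℕ)) := by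
    rintro k hk rfl
    rcases C.third h3 (by omega) hu f2 f3 with h | h
    · have := zmod_inj i (by omega) (by omega) h; omega
    · rw [add_assoc, ← Nat.cast_succ] at h
      have := zmod_inj i (by omega) (by omega) h
      apply f1
      rw [show t - 2 = k by omega]
  have hfe' : ∀ k, k < t → k + 1 ≠ m → f' ≠ C.edge (i + (k : ℕ)) := by
    rintro k hk hkm rfl
    rcases C.third h3 (by omega) hu f2' f3' with h | h
    · have := zmod_inj i (by omega) (by omega) h; omega
    · rw [add_assoc, ← Nat.cast_succ] at h
      by_cases hkt : k + 1 = t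
      · have h4 : (i + ((k + 1 : ℕ) : ZMod t)) = i + ((0 : ℕ) : ZMod t) := by rw [hkt]; simp
        rw [Nat.succ_eq_add_one, h4] at h
        have := zmod_inj i (by omega) (by omega) h
        omega
      have := zmod_inj i (by omega) (by omega) h
      apply f1'
      rw [show m - 2 = k by omega]
  refine ⟨?_, ?_, ?_, ?_, ?_⟩
  · intro a b ha hb hab
    try dsimp only at hab
    split_ifs at hab
    all_goals first
      | omega
      | exact absurd hab (hune _)
      | exact absurd hab (hune' _)
      | (have := vinj _ _ (by omega) (by omega) hab; omega)
  · intro a b ha hb hab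
    try dsimp only at hab
    split_ifs at hab
    all_goals first
      | omega
      | exact absurd hab hff
      | exact absurd hab.symm hff
      | exact absurd hab (hfe _ (by omega))
      | exact absurd hab.symm (hfe _ (by omega))
      | exact absurd hab (hfe' _ (by omega) (by omega))
      | exact absurd hab.symm (hfe' _ (by omega) (by omega))
      | (have := einj _ _ (by omega) (by omega) hab; omega)
  · intro a ha
    try dsimp only
    split_ifs
    all_goals first
      | exact C.edge_mem _
      | assumption
  · intro a ha
    try dsimp only
    split_ifs
    any_goals omega
    all_goals try assumption
    · exact C.mem_fst _
    · rwa [show a = m - 1 by omega]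
    · have := hsnd (t + m - 1 - a)
      rwa [show t + m - 1 - a + 1 = t + m - a by omega] at this
  · intro a ha
    try dsimp only
    split_ifs
    any_goals omega
    all_goals try assumption
    · exact hsnd _
    · rwa [show t + m - (a + 1) = t - 1 by omega]
    · rw [show t + m - (a + 1) = t + m - 1 - a by omega]
      exact C.mem_fst _

/-- The cycle edges `e_k`, other than `e_i`, `e_{i-1}`, through `v_i`. -/
def BergeCycle.rr {V : Type*} {H : Finset (Finset V)} {t : ℕ} (C : BergeCycle H t)
    (i : ZMod t) : Set (Finset V) :=
  {e | ∃ k, k ≠ i ∧ k ≠ i - 1 ∧ C.vtx i ∈ C.edge k ∧ e = C.edge k}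

theorem BergeCycle.rr_finite {V : Type*} {H : Finset (Finset V)} {t : ℕ} (C : BergeCycle H t)
    (i : ZMod t) : (C.rr i).Finite := by
  refine H.finite_toSet.subset ?_
  rintro e ⟨k, -, -, -, rfl⟩
  exact C.edge_mem k

theorem BergeCycle.pair {V : Type*} [Fintype V] {H : Finset (Finset V)} (h3 : IsThreeGraph H)
    {t : ℕ} (ht : 4 ≤ t) (C : BergeCycle H t) {u : V} (hu : u ∉ Set.range C.vtx)
    (hno : IsEmpty (BergeCycle H (t + 1))) {U : Set (ZMod t)} (hU : Usable C u U)
    {i j : ZMod t} (hi : i ∈ U) (hj : j ∈ U) (hij : i ≠ j) :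
    (HAdj H (C.vtx i) (C.vtx j) → C.vtx j ∈ C.edge i ∨ C.vtx i ∈ C.edge j) ∧
    shadowDeg H (C.vtx i) + shadowDeg H (C.vtx j) ≤
      t + 8 + (C.rr i).ncard + (C.rr j).ncard + 2 * (Fintype.card V - (t + 1)) := by
  have : NeZero t := ⟨by omega⟩
  have : Fact (1 < t) := ⟨by omega⟩
  obtain ⟨m, hm, rfl⟩ : ∃ m : ℕ, m < t ∧ j = i + m :=
    ⟨(j - i).val, ZMod.val_lt _, by rw [ZMod.natCast_zmod_val]; ring⟩
  obtain ⟨hn1, hn2⟩ := hU.2.1 i hi _ hj hij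
  have m0 : m ≠ 0 := by rintro rfl; simp at hij
  have m1 : m ≠ 1 := by rintro rfl; simp at hn1
  have m2 : m ≠ t - 1 := by
    rintro rfl
    apply hn2
    rw [← zmod_sub_one ht i t (by omega)]; simp
  obtain ⟨f, hf, f', hf', hff, f1, f2, f3, f1', f2', f3'⟩ := hU.2.2 i hi _ hj hij
  have P := C.path h3 ht hu i m (by omega) (by omega) hf hf' hff f1 f2 f3 f1' f2' f3'
  have hi1 : i - 1 = i + ((t - 1 : ℕ) : ZMod t) := by
    rw [← zmod_sub_one ht i t (by omega)]; simp
  have hj1 := zmod_sub_one ht i m (by omega)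
  have zne : ∀ a b : ℕ, a < t → b < t → a ≠ b → i + (a : ZMod t) ≠ i + (b : ZMod t) :=
    fun a b ha hb hab h => hab (zmod_inj i ha hb h)
  have hi0 : i = i + ((0 : ℕ) : ZMod t) := by simp
  set x : ℕ → V := (fun r => if r < m then C.vtx (i + r) else if r = m then u else
        C.vtx (i + ((t + m - r : ℕ) : ZMod t))) with hx
  set y : ℕ → Finset V := (fun r => if r + 1 < m then C.edge (i + r) else if r + 1 = m then f' else
        if r = m then f else C.edge (i + ((t + m - 1 - r : ℕ) : ZMod t))) with hy
  have x0 : x 0 = C.vtx i := by simp [hx, Nat.pos_of_ne_zero m0]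
  have xt : x t = C.vtx (i + m) := by
    simp only [hx]
    rw [if_neg (by omega), if_neg (by omega), show t + m - t = m by omega]
  have y0 : y 0 = C.edge i := by
    simp only [hy]; rw [if_pos (by omega)]; simp
  have yt : y (t - 1) = C.edge (i + m) := by
    simp only [hy]
    rw [if_neg (by omega), if_neg (by omega), if_neg (by omega),
      show t + m - 1 - (t - 1) = m by omega]
  constructor
  · intro h
    rw [← x0, ← xt] at h
    have := P.ends (by omega) h3 hno h
    rwa [y0, yt, x0, xt] at this
  · have ins : ∀ S : Set (Finset V), S.Finite → (insert f (insert f' S)).ncard ≤ S.ncard + 2 := by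
      intro S hS
      have h1 := Set.ncard_insert_le f (insert f' S)
      have h2 := Set.ncard_insert_le f' S
      omega
    have hA : {e | e ∈ H ∧ ∃ r, r < t ∧ 1 ≤ r ∧ e = y r ∧ x 0 ∈ e}.ncard ≤
        (C.rr i).ncard + 2 := by
      refine le_trans (Set.ncard_le_ncard ?_ (((C.rr_finite i).insert f').insert f))
        (ins _ (C.rr_finite i))
      rintro e ⟨he, r, hr, hr1, hey, hxe⟩
      rw [x0] at hxe
      simp only [hy] at hey
      split_ifs at hey with h1 h2 h3
      · right; right
        subst hey
        refine ⟨_, ?_, ?_, hxe, rfl⟩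
        · nth_rewrite 2 [hi0]
          exact zne _ _ (by omega) (by omega) (by omega)
        · rw [hi1]; exact zne _ _ (by omega) (by omega) (by omega)
      · right; left; exact hey
      · left; exact hey
      · right; right
        subst hey
        refine ⟨_, ?_, ?_, hxe, rfl⟩
        · nth_rewrite 2 [hi0]
          exact zne _ _ (by omega) (by omega) (by omega)
        · rw [hi1]; exact zne _ _ (by omega) (by omega) (by omega)
    have hB : {e | e ∈ H ∧ ∃ r, r < t ∧ r + 1 < t ∧ e = y r ∧ x t ∈ e}.ncard ≤
        (C.rr (i + m)).ncard + 2 := by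
      refine le_trans (Set.ncard_le_ncard ?_ (((C.rr_finite (i + m)).insert f').insert f))
        (ins _ (C.rr_finite (i + m)))
      rintro e ⟨he, r, hr, hr1, hey, hxe⟩
      rw [xt] at hxe
      simp only [hy] at hey
      split_ifs at hey with h1 h2 h3
      · right; right
        subst hey
        refine ⟨_, ?_, ?_, hxe, rfl⟩
        · exact zne _ _ (by omega) (by omega) (by omega)
        · rw [hj1]; exact zne _ _ (by omega) (by omega) (by omega)
      · right; left; exact hey
      · left; exact hey
      · right; right
        subst hey
        refine ⟨_, ?_, ?_, hxe, rfl⟩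
        · exact zne _ _ (by omega) (by omega) (by omega)
        · rw [hj1]; exact zne _ _ (by omega) (by omega) (by omega)
    have := P.deg h3 hno hA hB
    rw [x0, xt] at this
    omega

theorem BergeCycle.sum_rr {V : Type*} {H : Finset (Finset V)} (h3 : IsThreeGraph H)
    {t : ℕ} (ht : 4 ≤ t) (C : BergeCycle H t) (S : Finset (ZMod t)) :
    ∑ i ∈ S, (C.rr i).ncard ≤ t := by
  classical
  have : NeZero t := ⟨by omega⟩
  have : Fact (1 < t) := ⟨by omega⟩
  have h1 : ∀ i ∈ S, (C.rr i).ncard = (C.rr_finite i).toFinset.card := fun i _ =>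
    Set.ncard_eq_toFinset_card _ (C.rr_finite i)
  rw [Finset.sum_congr rfl h1, ← Finset.card_biUnion]
  · have : S.biUnion (fun i => (C.rr_finite i).toFinset) ⊆ Finset.univ.image C.edge := by
      intro e he
      simp only [Finset.mem_biUnion, Set.Finite.mem_toFinset] at he
      obtain ⟨i, -, k, -, -, -, rfl⟩ := he
      simp
    have h := (Finset.card_le_card this).trans Finset.card_image_le
    rwa [Finset.card_univ, ZMod.card] at h
  · intro i _ j _ hij
    rw [Function.onFun, Finset.disjoint_left]
    intro e he he'
    simp only [Set.Finite.mem_toFinset] at he he'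
    obtain ⟨k, hk1, hk2, hk3, rfl⟩ := he
    obtain ⟨k', hk1', hk2', hk3', hk⟩ := he'
    obtain rfl := C.edge_inj hk
    refine card_four h3 (C.edge_mem k) hk3 hk3' (C.mem_fst k) (C.mem_snd k)
      (C.vtx_inj.ne hij) (C.vtx_inj.ne hk1.symm) (C.vtx_inj.ne ?_) (C.vtx_inj.ne hk1'.symm)
      (C.vtx_inj.ne ?_) (C.vtx_inj.ne (by simp))
    · rintro rfl; simp at hk2
    · rintro rfl; simp at hk2'

theorem BergeCycle.key {V : Type*} [Fintype V] {H : Finset (Finset V)} (h3 : IsThreeGraph H)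
    {n t : ℕ} (ht : 4 ≤ t) (C : BergeCycle H t) {u : V} (hu : u ∉ Set.range C.vtx)
    (hno : IsEmpty (BergeCycle H (t + 1))) {U : Set (ZMod t)} (hU : Usable C u U)
    (hcard : Fintype.card V = n) (htn : t = n - 1 ∨ t = n - 2)
    (hOre : ∀ u v : V, u ≠ v → ¬ HAdj H u v → n + 65 ≤ shadowDeg H u + shadowDeg H v) :
    29 * U.ncard < n + 87 := by
  classical
  have : NeZero t := ⟨by omega⟩
  have : Fact (1 < t) := ⟨by omega⟩
  rw [Set.ncard_eq_toFinset_card' U]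
  set S := U.toFinset with hS
  set L := S.filter (fun i => (C.rr i).ncard ≤ 28) with hL
  have hpair : ∀ i ∈ L, ∀ j ∈ L, i ≠ j → C.vtx j ∈ C.edge i ∨ C.vtx i ∈ C.edge j := by
    intro i hi j hj hij
    simp only [hL, hS, Finset.mem_filter, Set.mem_toFinset] at hi hj
    obtain ⟨p1, p2⟩ := C.pair h3 ht hu hno hU hi.1 hj.1 hij
    apply p1
    by_contra hna
    have := hOre _ _ (C.vtx_inj.ne hij) hna
    omega
  have hL3 : L.card ≤ 3 := by
    set A := L.offDiag.filter (fun p => C.vtx p.2 ∈ C.edge p.1) with hA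
    have hAc : A.card ≤ L.card := by
      apply Finset.card_le_card_of_injOn (fun p => p.1)
      · intro p hp
        simp only [hA, Finset.coe_filter, Set.mem_ofPred_eq, Finset.mem_offDiag] at hp
        exact hp.1.1
      · rintro ⟨a, b⟩ hp ⟨a', b'⟩ hp' h
        simp only [hA, Finset.coe_filter, Set.mem_ofPred_eq, Finset.mem_offDiag] at hp hp' h
        subst h
        by_contra hne
        have hbb : b ≠ b' := by rintro rfl; exact hne rfl
        have hLU : ∀ z ∈ L, z ∈ U := by
          intro z hz
          simp only [hL, hS, Finset.mem_filter, Set.mem_toFinset] at hz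
          exact hz.1
        have n1 := hU.2.1 a (hLU _ hp.1.1) b (hLU _ hp.1.2.1) hp.1.2.2
        have n2 := hU.2.1 a (hLU _ hp.1.1) b' (hLU _ hp'.1.2.1) hp'.1.2.2
        exact card_four h3 (C.edge_mem a) hp.2 hp'.2 (C.mem_fst a) (C.mem_snd a)
          (C.vtx_inj.ne hbb) (C.vtx_inj.ne hp.1.2.2.symm) (C.vtx_inj.ne n1.1)
          (C.vtx_inj.ne hp'.1.2.2.symm) (C.vtx_inj.ne n2.1) (C.vtx_inj.ne (by simp))
    have hsub : L.offDiag ⊆ A ∪ A.image Prod.swap := by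
      rintro ⟨a, b⟩ hp
      have hp' := Finset.mem_offDiag.mp hp
      simp only [Finset.mem_union, Finset.mem_image]
      rcases hpair a hp'.1 b hp'.2.1 hp'.2.2 with h | h
      · left
        exact Finset.mem_filter.mpr ⟨hp, h⟩
      · right
        refine ⟨(b, a), Finset.mem_filter.mpr ⟨?_, h⟩, rfl⟩
        exact Finset.mem_offDiag.mpr ⟨hp'.2.1, hp'.1, hp'.2.2.symm⟩
    have h1 := (Finset.card_le_card hsub).trans (Finset.card_union_le _ _)
    have h2 : (A.image Prod.swap).card ≤ A.card := Finset.card_image_le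
    rw [Finset.offDiag_card] at h1
    by_contra hcon
    have : 4 * L.card ≤ L.card * L.card := Nat.mul_le_mul_right _ (by omega)
    omega
  have hsum := C.sum_rr h3 ht (S.filter (fun i => ¬ (C.rr i).ncard ≤ 28))
  have hlow := Finset.card_nsmul_le_sum (S.filter (fun i => ¬ (C.rr i).ncard ≤ 28))
    (fun i => (C.rr i).ncard) 29 (by
      intro i hi
      have := (Finset.mem_filter.mp hi).2
      omega)
  have hsplit : L.card + (S.filter (fun i => ¬ (C.rr i).ncard ≤ 28)).card = S.card := by
    rw [hL]
    convert Finset.card_filter_add_card_filter_not (s := S) (fun i => (C.rr i).ncard ≤ 28)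
  rw [smul_eq_mul] at hlow
  omega

/-- Existence of usable sets. -/
theorem BergeCycle.exists_usable {V : Type*} {H : Finset (Finset V)} (h3 : IsThreeGraph H)
    {t : ℕ} (ht : 4 ≤ t) (C : BergeCycle H t) {u : V} (hu : u ∉ Set.range C.vtx) :
    ∃ U : Set (ZMod t), Usable C u U ∧ C.dC u ≤ 8 * U.ncard := by
  classical
  have : NeZero t := ⟨by omega⟩
  have : Fact (1 < t) := ⟨by omega⟩
  have hune : ∀ b, u ≠ C.vtx b := fun b h => hu ⟨b, h.symm⟩
  -- good indices
  set G : Finset (ZMod t) := Finset.univ.filter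
    (fun i => ∃ e ∈ H, e ≠ C.edge (i - 2) ∧ u ∈ e ∧ C.vtx (i - 1) ∈ e) with hG
  have hGc : C.dC u ≤ 2 * G.card := by
    have hsub : {v | v ∈ Set.range C.vtx ∧ HAdj H u v} ⊆
        ((G.image (fun i => C.vtx (i - 1)) ∪ G.image (fun i => C.vtx i) : Finset V) : Set V) := by
      rintro v ⟨⟨k, rfl⟩, -, g, hg, hgu, hgk⟩
      simp only [Finset.coe_union, Set.mem_union, Finset.mem_coe, Finset.mem_image]
      by_cases hb : g = C.edge (k - 1)
      · right
        refine ⟨k, ?_, rfl⟩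
        simp only [hG, Finset.mem_filter, Finset.mem_univ, true_and]
        refine ⟨g, hg, ?_, hgu, ?_⟩
        · rw [hb]
          apply C.edge_inj.ne
          intro h
          have : (1 : ZMod t) = 0 := by linear_combination h
          exact one_ne_zero this
        · rw [hb]; exact C.mem_fst _
      · left
        refine ⟨k + 1, ?_, by simp⟩
        simp only [hG, Finset.mem_filter, Finset.mem_univ, true_and]
        refine ⟨g, hg, ?_, hgu, by simpa using hgk⟩
        rwa [show k + 1 - 2 = k - 1 by ring]
    have h := Set.ncard_le_ncard hsub (Finset.finite_toSet _)
    rw [Set.ncard_coe_finset] at h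
    have h1 := Finset.card_union_le (G.image (fun i => C.vtx (i - 1))) (G.image (fun i => C.vtx i))
    have h2 : (G.image (fun i => C.vtx (i - 1))).card ≤ G.card := Finset.card_image_le
    have h3 : (G.image (fun i => C.vtx i)).card ≤ G.card := Finset.card_image_le
    unfold BergeCycle.dC
    omega
  have hch : ∀ i : ZMod t, ∃ e : Finset V, i ∈ G →
      e ∈ H ∧ e ≠ C.edge (i - 2) ∧ u ∈ e ∧ C.vtx (i - 1) ∈ e := by
    intro i
    by_cases hi : i ∈ G
    · obtain ⟨e, h1, h2⟩ := (Finset.mem_filter.mp hi).2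
      exact ⟨e, fun _ => ⟨h1, h2⟩⟩
    · exact ⟨∅, fun h => absurd h hi⟩
  choose g hg using hch
  let F : Finset (Finset (ZMod t)) := G.powerset.filter
    (fun S => ∀ i ∈ S, ∀ j ∈ S, i ≠ j → (j ≠ i + 1 ∧ j ≠ i - 1) ∧ g i ≠ g j)
  have hF : F.Nonempty := ⟨∅, by simp [F]⟩
  obtain ⟨S, hSF, hmax⟩ := Finset.exists_max_image F Finset.card hF
  obtain ⟨hSG, hS⟩ := Finset.mem_filter.mp hSF
  rw [Finset.mem_powerset] at hSG
  have hcov : G ⊆ S.biUnion (fun i => {i + 1, i - 1} ∪ G.filter (fun j => g i = g j)) := by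
    intro k hk
    by_contra hcon
    simp only [Finset.mem_biUnion, not_exists, not_and, Finset.mem_union, Finset.mem_insert,
      Finset.mem_singleton, Finset.mem_filter, not_or] at hcon
    have hkS : k ∉ S := fun h => (hcon k h).2 hk rfl
    have hins : insert k S ∈ F := by
      simp only [F, Finset.mem_filter, Finset.mem_powerset]
      refine ⟨Finset.insert_subset hk hSG, ?_⟩
      intro i hi j hj hij
      rw [Finset.mem_insert] at hi hj
      rcases hi with rfl | hi <;> rcases hj with rfl | hj
      · exact absurd rfl hij
      · obtain ⟨⟨c1, c2⟩, c3⟩ := hcon j hj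
        refine ⟨⟨?_, ?_⟩, fun h => c3 hk h.symm⟩
        · rintro rfl; exact c2 (by ring)
        · rintro rfl; exact c1 (by ring)
      · obtain ⟨⟨c1, c2⟩, c3⟩ := hcon i hi
        exact ⟨⟨c1, c2⟩, fun h => c3 hk h⟩
      · exact hS i hi j hj hij
    have := hmax _ hins
    rw [Finset.card_insert_of_notMem hkS] at this
    omega
  have hG4 : G.card ≤ S.card * 4 := by
    refine (Finset.card_le_card hcov).trans (Finset.card_biUnion_le_card_mul _ _ _ ?_)
    intro i hi
    have hgi := hg i (hSG hi)
    have h2 : (G.filter (fun j => g i = g j)).card ≤ 2 := by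
      have : (G.filter (fun j => g i = g j)).card ≤ ((g i).erase u).card := by
        apply Finset.card_le_card_of_injOn (fun j => C.vtx (j - 1))
        · intro j hj
          simp only [Finset.coe_filter, Set.mem_ofPred_eq] at hj
          have := hg j hj.1
          rw [Finset.mem_coe, Finset.mem_erase, hj.2]
          exact ⟨(hune _).symm, this.2.2.2⟩
        · intro a _ b _ h
          exact sub_left_injective (C.vtx_inj h)
      rw [Finset.card_erase_of_mem hgi.2.2.1] at this
      rcases h3 _ hgi.1 with h | h <;> omega
    have h1 := Finset.card_union_le {i + 1, i - 1} (G.filter (fun j => g i = g j))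
    have h3 : ({i + 1, i - 1} : Finset (ZMod t)).card ≤ 2 := Finset.card_le_two
    omega
  refine ⟨(S : Set (ZMod t)), ⟨?_, ?_, ?_⟩, ?_⟩
  · intro i hi
    exact ⟨g i, hg i (hSG hi)⟩
  · intro i hi j hj hij
    exact (hS i hi j hj hij).1
  · intro i hi j hj hij
    obtain ⟨a1, a2, a3, a4⟩ := hg i (hSG hi)
    obtain ⟨b1, b2, b3, b4⟩ := hg j (hSG hj)
    exact ⟨g i, a1, g j, b1, (hS i hi j hj hij).2, a2, a3, a4, b2, b3, b4⟩
  · rw [Set.ncard_coe_finset]; omega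

/-- Swapping `v_i` for `u`. -/
theorem BergeCycle.swap {V : Type*} {H : Finset (Finset V)} (h3 : IsThreeGraph H)
    {t : ℕ} (ht : 4 ≤ t) (C : BergeCycle H t) {u : V} (hu : u ∉ Set.range C.vtx) {i : ZMod t}
    {f e : Finset V} (hf : f ∈ H) (he : e ∈ H) (hef : e ≠ f) (f1 : f ≠ C.edge (i - 2))
    (f2 : u ∈ f) (f3 : C.vtx (i - 1) ∈ f) (e1 : e ≠ C.edge (i + 1)) (e2 : u ∈ e)
    (e3 : C.vtx (i + 1) ∈ e) :
    ∃ C' : BergeCycle H t, C.vtx i ∉ Set.range C'.vtx ∧ C.dC (C.vtx i) ≤ C'.dC (C.vtx i) := by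
  classical
  have : NeZero t := ⟨by omega⟩
  have : Fact (1 < t) := ⟨by omega⟩
  have hune : ∀ b, u ≠ C.vtx b := fun b h => hu ⟨b, h.symm⟩
  have hf' : ∀ k, k ≠ i - 1 → f ≠ C.edge k := by
    rintro k hk rfl
    rcases C.third h3 (by omega) hu f2 f3 with h | h
    · exact hk h.symm
    · apply f1; congr 1; linear_combination -h
  have he' : ∀ k, k ≠ i → e ≠ C.edge k := by
    rintro k hk rfl
    rcases C.third h3 (by omega) hu e2 e3 with h | h
    · apply e1; rw [h]
    · exact hk (add_right_cancel h).symm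
  have hi1 : i - 1 ≠ i := by simp
  have hi2 : i + 1 ≠ i := by simp
  refine ⟨⟨fun k => if k = i then u else C.vtx k,
    fun k => if k = i then e else if k = i - 1 then f else C.edge k, ?_, ?_, ?_, ?_, ?_⟩, ?_, ?_⟩
  · intro a b hab
    try dsimp only at hab
    split_ifs at hab with h1 h2 h2
    · rw [h1, h2]
    · exact absurd hab (hune _)
    · exact absurd hab.symm (hune _)
    · exact C.vtx_inj hab
  · intro a b hab
    try dsimp only at hab
    split_ifs at hab with h1 h2 h3 h4 h5 h6 h7 h8
    · rw [h1, h2]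
    · exact absurd hab hef
    · exact absurd hab (he' _ h2)
    · exact absurd hab.symm hef
    · rw [h4, h6]
    · exact absurd hab (hf' _ h6)
    · exact absurd hab.symm (he' _ h1)
    · exact absurd hab.symm (hf' _ h4)
    · exact C.edge_inj hab
  · intro k
    split_ifs
    · exact he
    · exact hf
    · exact C.edge_mem k
  · intro k
    split_ifs with h1 h2
    · exact e2
    · rw [h2]; exact f3
    · exact C.mem_fst k
  · intro k
    by_cases h1 : k = i
    · subst h1
      simpa using e3
    by_cases h2 : k = i - 1
    · subst h2
      simpa using f2
    have h4 : k + 1 ≠ i := fun h => h2 (by rw [← h]; ring)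
    simpa [h1, h2, h4] using C.mem_snd k
  · rintro ⟨k, hk⟩
    try dsimp only at hk
    split_ifs at hk with h
    · exact hune _ hk
    · exact h (C.vtx_inj hk)
  · unfold BergeCycle.dC
    apply Set.ncard_le_ncard
    · rintro v ⟨⟨k, rfl⟩, hv⟩
      refine ⟨⟨k, ?_⟩, hv⟩
      have : k ≠ i := by rintro rfl; exact hv.1 rfl
      simp [this]
    · refine (Set.finite_range _).subset fun v hv => hv.1

/-- Comparing the two degrees. -/
theorem BergeCycle.deg_le {V : Type*} [Fintype V] {H : Finset (Finset V)}
    {t : ℕ} (ht : 4 ≤ t) (C : BergeCycle H t) (w u : V) (hu : u ∉ Set.range C.vtx)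
    (hwu : ¬ HAdj H w u) :
    shadowDeg H w ≤ C.dC w + (Fintype.card V - (t + 1)) := by
  classical
  have : NeZero t := ⟨by omega⟩
  set Q : Finset V := insert u (Finset.univ.image C.vtx) with hQ
  have hQc : Q.card = t + 1 := by
    rw [hQ, Finset.card_insert_of_notMem, Finset.card_image_of_injective _ C.vtx_inj,
      Finset.card_univ, ZMod.card]
    simpa using hu
  have hsub : {v | HAdj H w v} ⊆ {v | v ∈ Set.range C.vtx ∧ HAdj H w v} ∪
      ((Finset.univ \ Q : Finset V) : Set V) := by
    intro v hv
    by_cases hvr : v ∈ Set.range C.vtx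
    · left; exact ⟨hvr, hv⟩
    · right
      have : v ≠ u := by rintro rfl; exact hwu hv
      simp only [hQ, Finset.coe_sdiff, Set.mem_sdiff, Finset.mem_coe, Finset.mem_insert,
        Finset.mem_image, Finset.mem_univ, true_and, not_or]
      exact ⟨this, hvr⟩
  have h := (Set.ncard_le_ncard hsub (Set.toFinite _)).trans (Set.ncard_union_le _ _)
  rw [Set.ncard_coe_finset, Finset.card_sdiff_of_subset (Finset.subset_univ _), hQc,
    Finset.card_univ] at h
  exact h

/-- Claim 7: for `v_i ∈ U_u ∩ B₁(C)`, if `v_{i+1}` is adjacent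
to `u`, then `E(u, v_{i+1}) = {e_{i+1}}`. -/
theorem stmt15 {V : Type*} [Fintype V] (n : ℕ) (hn : 69 ≤ n)
    (hcard : Fintype.card V = n) (H : Finset (Finset V)) (h3 : IsThreeGraph H)
    (hOre : ∀ u v : V, u ≠ v → ¬ HAdj H u v →
      n + 65 ≤ shadowDeg H u + shadowDeg H v)
    (hnoham : ¬ HamiltonianBergeCycle H)
    {t : ℕ} (C : BergeCycle H t)
    (hlong : ∀ (t' : ℕ) (C' : BergeCycle H t'), t' ≤ t)
    (ht : t = n - 1 ∨ t = n - 2)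
    (u : V) (hu : u ∉ Set.range C.vtx)
    (U : Set (ZMod t)) (hU : Usable C u U) (hUcard : (C.dC u : ℚ) / 6 ≤ U.ncard)
    (i : ZMod t) (hi : i ∈ U)
    (hiB1 : (n + 65 : ℚ) / 2 - 3 ≤ (C.dC (C.vtx i) : ℚ) ∧
      (C.dC (C.vtx i) : ℚ) < 3 * (n : ℚ) / 4 + 13)
    (hadj : HAdj H u (C.vtx (i + 1))) :
    {e | e ∈ H ∧ u ∈ e ∧ C.vtx (i + 1) ∈ e} = {C.edge (i + 1)} := by

  have : NeZero t := ⟨by omega⟩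
  have : Fact (1 < t) := ⟨by omega⟩
  have ht4 : 4 ≤ t := by omega
  have hno : IsEmpty (BergeCycle H (t + 1)) := ⟨fun C' => by have := hlong _ C'; omega⟩
  have hsw : ∀ f ∈ H, ∀ e ∈ H, f ≠ C.edge (i - 2) → u ∈ f → C.vtx (i - 1) ∈ f →
      e ≠ C.edge (i + 1) → u ∈ e → C.vtx (i + 1) ∈ e → e = f := by
    intro f hf e he f1 f2 f3 e1 e2 e3
    by_contra hef
    obtain ⟨C', hw, hd⟩ := C.swap h3 ht4 hu hf he hef f1 f2 f3 e1 e2 e3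
    obtain ⟨U', hU', hc'⟩ := C'.exists_usable h3 ht4 hw
    have hk := C'.key h3 ht4 hw hno hU' hcard ht hOre
    have h1 := hiB1.1
    have h2 : (C.dC (C.vtx i) : ℚ) ≤ C'.dC (C.vtx i) := by exact_mod_cast hd
    have h3' : (C'.dC (C.vtx i) : ℚ) ≤ 8 * U'.ncard := by exact_mod_cast hc'
    have h4 : (29 : ℚ) * U'.ncard < n + 87 := by exact_mod_cast hk
    have h5 : (69 : ℚ) ≤ n := by exact_mod_cast hn
    linarith
  have hmain : ∀ e ∈ H, u ∈ e → C.vtx (i + 1) ∈ e → e = C.edge (i + 1) := by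
    intro e he e2 e3
    by_contra e1
    obtain ⟨f, hf, f1, f2, f3⟩ := hU.1 i hi
    obtain rfl := hsw f hf e he f1 f2 f3 e1 e2 e3
    have hune : ∀ b, u ≠ C.vtx b := fun b h => hu ⟨b, h.symm⟩
    have two : (2 : ZMod t) ≠ 0 := by
      intro h
      have h' : ((2 : ℕ) : ZMod t) = 0 := by exact_mod_cast h
      rw [ZMod.natCast_eq_zero_iff] at h'
      have := Nat.le_of_dvd (by norm_num) h'
      omega
    have hi11 : i - 1 ≠ i + 1 := fun h => two (by linear_combination -h)
    -- the common edge is not on the cycle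
    have hnc : ∀ k, e ≠ C.edge k := by
      rintro k rfl
      rcases C.third h3 (by omega) hu e2 e3 with h | h
      · exact e1 (by rw [h])
      · rcases C.third h3 (by omega) hu f2 f3 with h' | h'
        · have : (1 : ZMod t) = 0 := by linear_combination h - h'
          exact one_ne_zero this
        · exact hi11 (h'.trans h.symm)
    have hvi : C.vtx i ∉ e := fun h => card_four h3 he e2 e3 f3 h (hune _) (hune _) (hune _)
      (C.vtx_inj.ne hi11.symm) (C.vtx_inj.ne (by simp)) (C.vtx_inj.ne (by simp))
    have hnadj : ¬ HAdj H (C.vtx i) u := by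
      rintro ⟨-, g, hg, g1, g2⟩
      have hge : e ≠ g := by rintro rfl; exact hvi g1
      have hgc : ∀ k, C.edge k ≠ g := by
        rintro k rfl
        rcases C.third h3 (by omega) hu g2 g1 with h | h
        · subst h
          exact hge (hsw e hf _ hg f1 f2 f3 (C.edge_inj.ne (by simp)) g2 (C.mem_snd _)).symm
        · have hk : k = i - 1 := by rw [h]; ring
          refine hge (hsw _ hg e he (C.edge_inj.ne ?_) g2 ?_ e1 e2 e3)
          · intro h6
            have : (1 : ZMod t) = 0 := by linear_combination h6 + h
            exact one_ne_zero this
          · rw [hk]; exact C.mem_fst _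
      have vinj : ∀ a b : ℕ, a < t → b < t → C.vtx (i + a) = C.vtx (i + b) → a = b :=
        fun a b ha hb h => zmod_inj i ha hb (C.vtx_inj h)
      have einj : ∀ a b : ℕ, a < t → b < t → C.edge (i + a) = C.edge (i + b) → a = b :=
        fun a b ha hb h => zmod_inj i ha hb (C.edge_inj h)
      have hsnd : ∀ a : ℕ, C.vtx (i + ((a + 1 : ℕ) : ZMod t)) ∈ C.edge (i + a) := by
        intro a
        have := C.mem_snd (i + a)
        rwa [add_assoc, ← Nat.cast_succ] at this
      have hi1 : i - 1 = i + ((t - 1 : ℕ) : ZMod t) := by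
        rw [← zmod_sub_one ht4 i t (by omega)]; simp
      have P : BPath H t (fun r => if r < t then C.vtx (i + r) else u)
          (fun r => if r + 1 < t then C.edge (i + r) else e) := by
        refine ⟨?_, ?_, ?_, ?_, ?_⟩
        · intro a b ha hb hab
          try dsimp only at hab
          split_ifs at hab
          · exact vinj _ _ (by omega) (by omega) hab
          · exact absurd hab.symm (hune _)
          · exact absurd hab (hune _)
          · omega
        · intro a b ha hb hab
          try dsimp only at hab
          split_ifs at hab
          · exact einj _ _ (by omega) (by omega) hab
          · exact absurd hab.symm (hnc _)
          · exact absurd hab (hnc _)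
          · omega
        · intro a ha
          try dsimp only
          split_ifs
          · exact C.edge_mem _
          · exact he
        · intro a ha
          try dsimp only
          split_ifs
          · exact C.mem_fst _
          · rw [show a = t - 1 by omega, ← hi1]; exact f3
        · intro a ha
          try dsimp only
          split_ifs
          · exact hsnd a
          · exact e2
      refine hno.elim (P.close hg ?_ ?_ ?_).some
      · simpa [show 0 < t by omega] using g1
      · simpa using g2
      · intro r hr
        try dsimp only
        split_ifs
        · exact hgc _
        · exact hge
    have hO := hOre (C.vtx i) u (hune i).symm hnadj
    have d1 := C.deg_le ht4 (C.vtx i) u hu hnadj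
    have d2 := C.deg_le ht4 u u hu (fun h => h.1 rfl)
    have hk := C.key h3 ht4 hu hno hU hcard ht hOre
    have d3 : n + 63 ≤ C.dC (C.vtx i) + C.dC u := by omega
    have h1 := hiB1.2
    have h3' : (n + 63 : ℚ) ≤ C.dC (C.vtx i) + C.dC u := by exact_mod_cast d3
    have h4 : (29 : ℚ) * U.ncard < n + 87 := by exact_mod_cast hk
    have h5 : (69 : ℚ) ≤ n := by exact_mod_cast hn
    linarith
  obtain ⟨-, e0, he0, h01, h02⟩ := hadj
  ext e
  simp only [Set.mem_ofPred_eq, Set.mem_singleton_iff]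
  constructor
  · rintro ⟨h1, h2, h4⟩
    exact hmain e h1 h2 h4
  · rintro rfl
    rw [← hmain e0 he0 h01 h02]
    exact ⟨he0, h01, h02⟩
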